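/- arXiv:2402.13719 — 2 statements merged into one kernel-verified Lean document; each statement's English description precedes it below -/
import Mathlib

section
/- Let μ^(0) be a valid starting value and let (μ^(k))_{k≥0} be the iterates of Algorithm 1. Then the sequence is bounded above: μ_j^(k) ≤ p_j^{−1}(α) for all k ≥ 0 and all j; consequently the componentwise non-decreasing sequence (μ^(k)) converges to a limit μ^∞ ∈ ℝ^m. -/
open Filter Topology

/-- Dividing a strictly increasing positive function by `q ^ max t 0` with `q ∈ (0, 1)` keeps it
strictly increasing. -/
theorem strictMono_mul_rpow_neg_max {q : ℝ} (hq0 : 0 < q) (hq1 : q < 1) {f : ℝ → ℝ}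
    (hf : StrictMono f) (hpos : ∀ t, 0 < f t) :
    StrictMono fun t => f t * q ^ (-(max t 0)) := fun _ _ hst =>
  mul_lt_mul (hf hst)
    (Real.rpow_le_rpow_of_exponent_ge hq0 hq1.le (neg_le_neg (max_le_max_right 0 hst.le)))
    (Real.rpow_pos_of_pos hq0 _) (hpos _).le

/-- The iterates of Algorithm 1 are bounded above by `(p j)⁻¹ α` in each component;
consequently the componentwise non-decreasing sequence of iterates converges to a limit
`μ^∞ ∈ ℝ^m`. -/
theorem stmt3 (m : ℕ) (hm : 1 ≤ m)
    (q α : ℝ) (hq : q ∈ Set.Ioo (0 : ℝ) 1) (hα : α ∈ Set.Ioo (0 : ℝ) 1)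
    (p : Fin m → ℝ → ℝ)
    (hp_cont : ∀ j, Continuous (p j))
    (hp_mono : ∀ j, StrictMono (p j))
    (hp_range : ∀ j t, p j t ∈ Set.Ioo (0 : ℝ) 1)
    (hp_bot : ∀ j, Tendsto (p j) atBot (nhds 0))
    (hp_top : ∀ j, Tendsto (p j) atTop (nhds 1))
    (ν : Fin m → (Fin m → ℝ) → ℝ)
    (hν_cont : ∀ j, Continuous (ν j))
    (hν_mono : ∀ j, Monotone (ν j))
    (hν_pos : ∀ j μ, 0 < ν j μ)
    (hw_sum : ∀ μ : Fin m → ℝ, ∑ j, q ^ max (μ j) 0 * ν j μ = 1)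
    (μ : ℕ → Fin m → ℝ)
    (hstart : ∀ j, p j (μ 0 j) * q ^ (-(max (μ 0 j) 0)) ≤ ν j (μ 0) * α)
    (hstep : ∀ k j, p j (μ (k + 1) j) * q ^ (-(max (μ (k + 1) j) 0)) = ν j (μ k) * α)
    -- `T j` is the value `(p j)⁻¹ α` of the inverse p-value function
    (T : Fin m → ℝ) (hT : ∀ j, p j (T j) = α) :
    (∀ k j, μ k j ≤ T j)
    ∧ ∃ μinf : Fin m → ℝ, ∀ j, Tendsto (fun k => μ k j) atTop (nhds (μinf j)) := by
  obtain ⟨hq0, hq1⟩ := hq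
  have hstrict j := strictMono_mul_rpow_neg_max hq0 hq1 (hp_mono j) fun t => (hp_range j t).1
  have hvalid : ∀ k j, p j (μ k j) * q ^ (-(max (μ k j) 0)) ≤ ν j (μ k) * α := by
    intro k
    induction k with
    | zero => exact hstart
    | succ k ih =>
      intro j
      have hle : μ k ≤ μ (k + 1) := fun i =>
        (hstrict i).le_iff_le.mp ((ih i).trans (hstep k i).ge)
      rw [hstep k j]
      exact mul_le_mul_of_nonneg_right (hν_mono j hle) hα.1.le
  have hbound : ∀ k j, μ k j ≤ T j := by
    intro k j
    have hw : q ^ max (μ k j) 0 * ν j (μ k) ≤ 1 := by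
      rw [← hw_sum (μ k)]
      exact Finset.single_le_sum
        (f := fun i => q ^ max (μ k i) 0 * ν i (μ k))
        (fun i _ => mul_nonneg (Real.rpow_nonneg hq0.le _) (hν_pos i _).le) (Finset.mem_univ j)
    rw [← (hp_mono j).le_iff_le, hT j]
    have h := hvalid k j
    rw [Real.rpow_neg hq0.le, ← div_eq_mul_inv, div_le_iff₀ (Real.rpow_pos_of_pos hq0 _)] at h
    nlinarith [mul_le_mul_of_nonneg_right hw hα.1.le]
  refine ⟨hbound, fun j => ⨆ k, μ k j, fun j => tendsto_atTop_ciSup ?_ ?_⟩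
  · exact monotone_nat_of_le_succ fun k =>
      (hstrict j).le_iff_le.mp ((hvalid k j).trans (hstep k j).ge)
  · exact ⟨T j, Set.forall_mem_range.mpr fun k => hbound k j⟩
end

section
/- For every δ ∈ ℝ^m, with the lower half-space H(δ) = ⋃_{j=1}^m {μ ∈ ℝ^m : μ_j ≤ δ_j}, the following equivalence holds: δ_j ≤ L_j for all j = 1,…,m if and only if p(μ) ≤ α for all μ ∈ H(δ). -/
open Filter Topology

/-- The adjusted p-value `p(μ) = min { p j (μ j) / w j μ : w j μ > 0 }`, where
`w j μ = q ^ max (μ j) 0 * ν j μ`. -/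
noncomputable def padj (q : ℝ) {m : ℕ} (p : Fin m → ℝ → ℝ)
    (ν : Fin m → (Fin m → ℝ) → ℝ) (μ : Fin m → ℝ) : ℝ :=
  sInf {x : ℝ | ∃ j : Fin m,
    0 < q ^ max (μ j) 0 * ν j μ ∧ x = p j (μ j) / (q ^ max (μ j) 0 * ν j μ)}

/-- `α` lies strictly below the adjusted p-value iff every weighted threshold is met strictly. -/
theorem lt_padj_iff {q α : ℝ} {m : ℕ} {p : Fin m → ℝ → ℝ} {ν : Fin m → (Fin m → ℝ) → ℝ}
    {μ : Fin m → ℝ} (hp : ∀ j, 0 < p j (μ j)) (hw : ∀ j, 0 ≤ q ^ max (μ j) 0 * ν j μ)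
    (hsum : ∑ j, q ^ max (μ j) 0 * ν j μ = 1) :
    α < padj q p ν μ ↔ ∀ j, α * (q ^ max (μ j) 0 * ν j μ) < p j (μ j) := by
  unfold padj
  set S := {x : ℝ | ∃ j : Fin m,
    0 < q ^ max (μ j) 0 * ν j μ ∧ x = p j (μ j) / (q ^ max (μ j) 0 * ν j μ)}
  have hfin : S.Finite :=
    (Set.finite_range fun j => p j (μ j) / (q ^ max (μ j) 0 * ν j μ)).subset (by
      rintro x ⟨j, -, rfl⟩
      exact ⟨j, rfl⟩)
  have hne : S.Nonempty := by
    obtain ⟨j, -, hj⟩ : ∃ j ∈ Finset.univ, 0 < q ^ max (μ j) 0 * ν j μ :=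
      Finset.exists_lt_of_sum_lt (by simp [hsum])
    exact ⟨_, j, hj, rfl⟩
  rw [hfin.lt_csInf_iff hne]
  constructor
  · intro h j
    rcases (hw j).eq_or_lt with h0 | h0
    · simpa [← h0] using hp j
    · exact (lt_div_iff₀ h0).1 (h _ ⟨j, h0, rfl⟩)
  · rintro h x ⟨j, h0, rfl⟩
    exact (lt_div_iff₀ h0).2 (h j)

/-- The infimum of a coordinate over an open set is not attained. -/
theorem lt_apply_of_isGLB_of_isOpen {ι : Type*} {C : Set (ι → ℝ)} (hC : IsOpen C) {j : ι} {l : ℝ}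
    (hl : IsGLB ((fun μ => μ j) '' C) l) {μ : ι → ℝ} (hμ : μ ∈ C) : l < μ j := by
  classical
  have hcont : Continuous fun t => Function.update μ j t := continuous_const.update j continuous_id
  have hnhds : ∀ᶠ t in 𝓝 (μ j), Function.update μ j t ∈ C :=
    hcont.continuousAt.eventually_mem (hC.mem_nhds (by simpa using hμ))
  obtain ⟨t, ht, htlt⟩ :=
    ((hnhds.filter_mono nhdsWithin_le_nhds).and (self_mem_nhdsWithin (s := Set.Iio (μ j)))).exists
  have hle : l ≤ t := hl.1 ⟨_, ht, by simp⟩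
  exact hle.trans_lt htlt

/-- For every `δ ∈ ℝ^m`, with the lower half-space `H(δ) = ⋃ j {μ : μ j ≤ δ j}`:
`δ j ≤ L j` for all `j` if and only if `p(μ) ≤ α` for all `μ ∈ H(δ)`, where
`L j` is the infimum of the `j`-th coordinates of the confidence set
`C = {μ : p(μ) > α}`. -/
theorem stmt9 (m : ℕ) (hm : 1 ≤ m)
    (q α : ℝ) (hq : q ∈ Set.Ioo (0 : ℝ) 1) (hα : α ∈ Set.Ioo (0 : ℝ) 1)
    (p : Fin m → ℝ → ℝ)
    (hp_cont : ∀ j, Continuous (p j))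
    (hp_mono : ∀ j, StrictMono (p j))
    (hp_range : ∀ j t, p j t ∈ Set.Ioo (0 : ℝ) 1)
    (hp_bot : ∀ j, Tendsto (p j) atBot (nhds 0))
    (hp_top : ∀ j, Tendsto (p j) atTop (nhds 1))
    (ν : Fin m → (Fin m → ℝ) → ℝ)
    (hν_cont : ∀ j, Continuous (ν j))
    (hν_mono : ∀ j, Monotone (ν j))
    (hν_nonneg : ∀ j μ, 0 ≤ ν j μ)
    (hw_sum : ∀ μ : Fin m → ℝ, ∑ j, q ^ max (μ j) 0 * ν j μ = 1)
    (hCne : {μ : Fin m → ℝ | α < padj q p ν μ}.Nonempty)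
    (L : Fin m → ℝ)
    (hL : ∀ j, IsGLB ((fun μ => μ j) '' {μ : Fin m → ℝ | α < padj q p ν μ}) (L j))
    (δ : Fin m → ℝ) :
    (∀ j, δ j ≤ L j) ↔
      ∀ μ ∈ ⋃ j : Fin m, {ρ : Fin m → ℝ | ρ j ≤ δ j}, padj q p ν μ ≤ α := by
  have hiff : ∀ μ, α < padj q p ν μ ↔ ∀ j, α * (q ^ max (μ j) 0 * ν j μ) < p j (μ j) := fun μ =>
    lt_padj_iff (fun j => (hp_range j _).1)
      (fun j => mul_nonneg (Real.rpow_nonneg hq.1.le _) (hν_nonneg j μ)) (hw_sum μ)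
  have hopen : IsOpen {μ : Fin m → ℝ | α < padj q p ν μ} := by
    simp only [hiff, Set.ofPred_forall]
    refine isOpen_iInter_of_finite fun j => isOpen_lt ?_ ?_
    · have hpow : Continuous fun μ : Fin m → ℝ => q ^ max (μ j) 0 :=
        (Real.continuous_const_rpow hq.1.ne').comp ((continuous_apply j).max continuous_const)
      exact continuous_const.mul (hpow.mul (hν_cont j))
    · exact (hp_cont j).comp (continuous_apply j)
  constructor
  · intro h μ hμ
    obtain ⟨j, hj⟩ := Set.mem_iUnion.1 hμ
    by_contra! hlt
    exact (lt_apply_of_isGLB_of_isOpen hopen (hL j) hlt).not_ge (hj.trans (h j))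
  · intro h j
    refine (hL j).2 ?_
    rintro _ ⟨μ, hμ, rfl⟩
    by_contra! hlt
    exact (h μ (Set.mem_iUnion.2 ⟨j, hlt.le⟩)).not_gt hμ
end
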